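/- arXiv:2408.14455 — 3 statements merged into one kernel-verified Lean document; each statement's English description precedes it below -/
import Mathlib

section
/- Let w = (w_1,…,w_n) be a permutation of {1,…,n} whose ad-pattern contains the word aadd as a contiguous factor, or begins with the word add, or ends with the word aad. Then the chromatic quasisymmetric function of the labeled path P_w is not symmetric. -/
/-- A proper coloring of a labeled graph on vertex set `Fin n` (vertex `v` represents
label `v+1`), with colors in `{1,2,...}`. -/
def properColoring {n : ℕ} (G : SimpleGraph (Fin n)) (c : Fin n → ℕ) : Prop :=
  ∀ u v : Fin n, G.Adj u v → c u ≠ c v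

/-- The ascent number of a coloring: the number of edges `uv` with `u < v` and `c u < c v`. -/
noncomputable def ascNum {n : ℕ} (G : SimpleGraph (Fin n)) (c : Fin n → ℕ) : ℕ :=
  Nat.card {p : Fin n × Fin n // p.1 < p.2 ∧ G.Adj p.1 p.2 ∧ c p.1 < c p.2}

/-- The descent number of a coloring: the number of edges `uv` with `u < v` and `c u > c v`. -/
noncomputable def desNum {n : ℕ} (G : SimpleGraph (Fin n)) (c : Fin n → ℕ) : ℕ :=
  Nat.card {p : Fin n × Fin n // p.1 < p.2 ∧ G.Adj p.1 p.2 ∧ c p.2 < c p.1}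

/-- The coloring `c` uses exactly the colors `1,…,L.length`, color `a` being used
exactly `L.get (a-1)` times. -/
def usesPalette {n : ℕ} (L : List ℕ) (c : Fin n → ℕ) : Prop :=
  (∀ v : Fin n, 1 ≤ c v ∧ c v ≤ L.length) ∧
  ∀ i : Fin L.length, Nat.card {v : Fin n // c v = (i : ℕ) + 1} = L.get i

/-- `NG G L k` is the number of proper colorings of `G` with ascent number `k`
and palette `L`. -/
noncomputable def NG {n : ℕ} (G : SimpleGraph (Fin n)) (L : List ℕ) (k : ℕ) : ℕ :=
  Nat.card {c : Fin n → ℕ // properColoring G c ∧ usesPalette L c ∧ ascNum G c = k}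

/-- `L` is a composition of `n`: a list of positive integers summing to `n`. -/
def IsComposition (n : ℕ) (L : List ℕ) : Prop :=
  (∀ a ∈ L, 0 < a) ∧ L.sum = n

/-- The chromatic quasisymmetric function of `G` is symmetric. -/
def cqfSymmetric {n : ℕ} (G : SimpleGraph (Fin n)) : Prop :=
  ∀ L M : List ℕ, IsComposition n L → IsComposition n M → List.Perm L M →
    ∀ k : ℕ, NG G L k = NG G M k

/-- The number of edges of `G`. -/
noncomputable def edgeCount {n : ℕ} (G : SimpleGraph (Fin n)) : ℕ := Nat.card G.edgeSet

/-- The chromatic quasisymmetric function of `G` is palindromic. -/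
def cqfPalindromic {n : ℕ} (G : SimpleGraph (Fin n)) : Prop :=
  ∀ L : List ℕ, IsComposition n L →
    ∀ k : ℕ, k ≤ edgeCount G → NG G L k = NG G L (edgeCount G - k)

/-- The labeled path `P_w` of a permutation `w` of `Fin n`: edges `{w i, w (i+1)}`. -/
def pathGraph {n : ℕ} (w : Equiv.Perm (Fin n)) : SimpleGraph (Fin n) :=
  SimpleGraph.fromRel (fun u v => ∃ i : ℕ, ∃ h : i + 1 < n,
    u = w ⟨i, by omega⟩ ∧ v = w ⟨i + 1, h⟩)

/-- The flipped labeled graph: `uv` is an edge iff `(n+1-u)(n+1-v)` is an edge of `G`. -/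
def flipGraph {n : ℕ} (G : SimpleGraph (Fin n)) : SimpleGraph (Fin n) :=
  SimpleGraph.comap Fin.rev G

/-- The ascent-descent pattern of `w`, where `true` records an ascent (`a`) and
`false` records a descent (`d`). -/
def adPattern {n : ℕ} (w : Equiv.Perm (Fin n)) : List Bool :=
  List.ofFn (fun i : Fin (n - 1) =>
    decide (w ⟨(i : ℕ), by have := i.isLt; omega⟩ < w ⟨(i : ℕ) + 1, by have := i.isLt; omega⟩))

/-- The ribbon word `a^{α₁-1} d a^{α₂-1} d ⋯ d a^{α_ℓ-1}` of a composition. -/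
def ribbonWord : List ℕ → List Bool
  | [] => []
  | [a] => List.replicate (a - 1) true
  | a :: b :: rest => List.replicate (a - 1) true ++ false :: ribbonWord (b :: rest)

/-- Position `i` is a local minimum of `w`. -/
def LocalMinAt {n : ℕ} (w : Equiv.Perm (Fin n)) (i : Fin n) : Prop :=
  (∀ _ : 0 < (i : ℕ), w i < w ⟨(i : ℕ) - 1, by have := i.isLt; omega⟩) ∧
  (∀ h : (i : ℕ) + 1 < n, w i < w ⟨(i : ℕ) + 1, h⟩)

/-- Position `i` is a local maximum of `w`. -/
def LocalMaxAt {n : ℕ} (w : Equiv.Perm (Fin n)) (i : Fin n) : Prop :=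
  (∀ _ : 0 < (i : ℕ), w ⟨(i : ℕ) - 1, by have := i.isLt; omega⟩ < w i) ∧
  (∀ h : (i : ℕ) + 1 < n, w ⟨(i : ℕ) + 1, h⟩ < w i)

/-- The labeled star `K_{1,n-1}` with central vertex `j`. -/
def starGraph (n : ℕ) (j : Fin n) : SimpleGraph (Fin n) :=
  SimpleGraph.fromRel (fun u v => u = j ∧ v ≠ j)

/-- The ascent number of `c` equals the number of edges exactly when `c` increases along every edge
directed towards its larger endpoint. -/
theorem ascNum_eq_card_edges_iff {n : ℕ} (G : SimpleGraph (Fin n)) (c : Fin n → ℕ) :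
    ascNum G c = Nat.card {p : Fin n × Fin n // p.1 < p.2 ∧ G.Adj p.1 p.2} ↔
      ∀ u v, u < v → G.Adj u v → c u < c v := by
  classical
  have hsub : {p : Fin n × Fin n | p.1 < p.2 ∧ G.Adj p.1 p.2 ∧ c p.1 < c p.2} ⊆
      {p : Fin n × Fin n | p.1 < p.2 ∧ G.Adj p.1 p.2} := fun p hp => ⟨hp.1, hp.2.1⟩
  constructor
  · intro h u v huv hadj
    have heq := Set.eq_of_subset_of_ncard_le hsub (le_of_eq h.symm) (Set.toFinite _)
    have hmem : (u, v) ∈ {p : Fin n × Fin n | p.1 < p.2 ∧ G.Adj p.1 p.2} := ⟨huv, hadj⟩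
    rw [← heq] at hmem
    exact hmem.2.2
  · intro h
    refine congrArg Set.ncard (hsub.antisymm fun p hp => ⟨hp.1, hp.2, h _ _ hp.1 hp.2⟩)

theorem finite_usesPalette {n : ℕ} (L : List ℕ) : {c : Fin n → ℕ | usesPalette L c}.Finite := by
  refine (Set.Finite.pi' (t := fun _ : Fin n => Set.Icc 1 L.length)
    fun _ => Set.finite_Icc _ _).subset ?_
  intro c hc v
  exact hc.1 v

theorem NG_pos {n : ℕ} {G : SimpleGraph (Fin n)} {L : List ℕ} {k : ℕ} {c : Fin n → ℕ}
    (hproper : properColoring G c) (hpal : usesPalette L c) (hasc : ascNum G c = k) :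
    0 < NG G L k := by
  have hfin : Finite {c : Fin n → ℕ // properColoring G c ∧ usesPalette L c ∧ ascNum G c = k} :=
    ((finite_usesPalette L).subset fun _ hc => hc.2.1).to_subtype
  have : Nonempty {c : Fin n → ℕ // properColoring G c ∧ usesPalette L c ∧ ascNum G c = k} :=
    ⟨⟨c, hproper, hpal, hasc⟩⟩
  exact Nat.card_pos

/-- Every rank between `1` and `s.card` is attained by an element of `s`. -/
theorem exists_eq_card_filter_le {α : Type*} [LinearOrder α] (s : Finset α) {i : ℕ}
    (hi : i < s.card) : ∃ v ∈ s, (s.filter (· ≤ v)).card = i + 1 := by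
  refine ⟨s.orderEmbOfFin rfl ⟨i, hi⟩, s.orderEmbOfFin_mem rfl _, ?_⟩
  have : s.filter (· ≤ s.orderEmbOfFin rfl ⟨i, hi⟩) =
      (Finset.Iic (⟨i, hi⟩ : Fin s.card)).map (s.orderEmbOfFin rfl).toEmbedding := by
    ext x
    simp only [Finset.mem_filter, Finset.mem_map, Finset.mem_Iic]
    constructor
    · rintro ⟨hx, hle⟩
      have hx' : x ∈ Set.range (s.orderEmbOfFin rfl) := by
        rw [Finset.range_orderEmbOfFin]; exact hx
      obtain ⟨j, rfl⟩ := hx'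
      exact ⟨j, by simpa using hle, rfl⟩
    · rintro ⟨j, hj, rfl⟩
      exact ⟨s.orderEmbOfFin_mem rfl _, by simpa using hj⟩
  rw [this, Finset.card_map, Fin.card_Iic]

theorem card_filter_le_lt_card_filter_le {α : Type*} [LinearOrder α] (s : Finset α) {u v : α}
    (hv : v ∈ s) (huv : u < v) : (s.filter (· ≤ u)).card < (s.filter (· ≤ v)).card := by
  refine Finset.card_lt_card (Finset.ssubset_iff_of_subset ?_ |>.2 ⟨v, ?_, ?_⟩)
  · intro z hz
    simp only [Finset.mem_filter] at hz ⊢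
    exact ⟨hz.1, hz.2.trans huv.le⟩
  · simp [hv]
  · simp [huv]

/-- If a local maximum `b` of a labeled graph is the only larger neighbor of two vertices `x ≠ y`,
then the chromatic quasisymmetric function is not symmetric: replacing `b` by `x` and `y` turns
the set of local maxima into a larger set, which is a color class of some coloring increasing
along all edges, but never the last color class. -/
theorem not_cqfSymmetric_of_unique_larger_neighbor {n : ℕ} (G : SimpleGraph (Fin n))
    {b x y : Fin n} (hb : ∀ v, b < v → ¬ G.Adj b v) (hxy : x ≠ y)
    (hxb : x < b) (hxadj : G.Adj x b) (hx : ∀ v, x < v → G.Adj x v → v = b)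
    (hyb : y < b) (hyadj : G.Adj y b) (hy : ∀ v, y < v → G.Adj y v → v = b) :
    ¬ cqfSymmetric G := by
  classical
  intro hsymm
  set T : Finset (Fin n) := Finset.univ.filter fun u => ∀ v, u < v → ¬ G.Adj u v with hT
  have hbT : b ∈ T := by simpa [hT] using hb
  have hxT : x ∉ T := fun h => (Finset.mem_filter.1 h).2 b hxb hxadj
  have hyT : y ∉ T := fun h => (Finset.mem_filter.1 h).2 b hyb hyadj
  set A : Finset (Fin n) := insert x (insert y (T.erase b)) with hA
  have hAcard : A.card = T.card + 1 := by
    have h1 : y ∉ T.erase b := fun h => hyT (Finset.mem_of_mem_erase h)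
    have h2 : x ∉ insert y (T.erase b) := by
      simp only [Finset.mem_insert, not_or]
      exact ⟨hxy, fun h => hxT (Finset.mem_of_mem_erase h)⟩
    have h3 : 0 < T.card := Finset.card_pos.2 ⟨b, hbT⟩
    rw [hA, Finset.card_insert_of_notMem h2, Finset.card_insert_of_notMem h1,
      Finset.card_erase_of_mem hbT]
    omega
  have hbA : b ∉ A := by
    simp [hA, hxb.ne', hyb.ne']
  have hAlarger : ∀ u ∈ A, ∀ v, u < v → G.Adj u v → v = b := by
    intro u hu v huv hadj
    simp only [hA, Finset.mem_insert, Finset.mem_erase] at hu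
    rcases hu with rfl | rfl | ⟨-, hu⟩
    · exact hx v huv hadj
    · exact hy v huv hadj
    · exact absurd hadj ((Finset.mem_filter.1 hu).2 v huv)
  set S : Finset (Fin n) := (insert b A)ᶜ with hS
  have hSmem : ∀ v, v ∈ S ↔ v ≠ b ∧ v ∉ A := fun v => by simp [hS]
  have hcard : S.card + (A.card + 1) = n := by
    have := Finset.card_compl_add_card (insert b A)
    rwa [Finset.card_insert_of_notMem hbA, Fintype.card_fin] at this
  set r : Fin n → ℕ := fun v => (S.filter (· ≤ v)).card with hr
  have hr_le : ∀ v, r v ≤ S.card := fun v => Finset.card_filter_le _ _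
  have hr_pos : ∀ v ∈ S, 0 < r v := fun v hv => Finset.card_pos.2 ⟨v, by simp [hv]⟩
  set c : Fin n → ℕ := fun v => if v = b then S.card + 2 else if v ∈ A then S.card + 1 else r v
    with hc
  have hc_b : c b = S.card + 2 := if_pos rfl
  have hc_A : ∀ v ∈ A, c v = S.card + 1 := by
    intro v hv
    have hvb : v ≠ b := fun h => hbA (h ▸ hv)
    simp only [hc, if_neg hvb, if_pos hv]
  have hcS : ∀ v ∈ S, c v = r v := by
    intro v hv
    simp only [hc, if_neg ((hSmem v).1 hv).1, if_neg ((hSmem v).1 hv).2]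
  have hcases : ∀ v, v = b ∨ v ∈ A ∨ v ∈ S := by
    intro v
    rw [hSmem]
    tauto
  have hcb : ∀ v, c v = S.card + 2 ↔ v = b := by
    refine fun v => ⟨fun h => ?_, fun h => h ▸ hc_b⟩
    rcases hcases v with hv | hv | hv
    · exact hv
    · have := hc_A v hv
      omega
    · have := hcS v hv
      have := hr_le v
      omega
  have hcS_iff : ∀ v, c v ≤ S.card ↔ v ∈ S := by
    refine fun v => ⟨fun h => ?_, fun h => (hcS v h).trans_le (hr_le v)⟩
    rcases hcases v with hv | hv | hv
    · have := (hcb v).2 hv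
      omega
    · have := hc_A v hv
      omega
    · exact hv
  have hcA : ∀ v, c v = S.card + 1 ↔ v ∈ A := by
    refine fun v => ⟨fun h => ?_, hc_A v⟩
    rcases hcases v with hv | hv | hv
    · have := (hcb v).2 hv
      omega
    · exact hv
    · have := (hcS_iff v).2 hv
      omega
  have hc_le : ∀ v, 1 ≤ c v ∧ c v ≤ S.card + 2 := by
    intro v
    rcases hcases v with hv | hv | hv
    · have := (hcb v).2 hv
      omega
    · have := hc_A v hv
      omega
    · have := hr_le v
      have := hr_pos v hv
      rw [hcS v hv]
      omega
  have hinc : ∀ u v, u < v → G.Adj u v → c u < c v := by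
    intro u v huv hadj
    have hub : u ≠ b := by
      rintro rfl
      exact hb v huv hadj
    have hcu : c u ≠ S.card + 2 := mt (hcb u).1 hub
    by_cases hvb : v = b
    · have := (hcb v).2 hvb
      have := hc_le u
      omega
    have huS : u ∈ S := (hSmem u).2 ⟨hub, fun h => hvb (hAlarger u h v huv hadj)⟩
    by_cases hvS : v ∈ S
    · rw [hcS u huS, hcS v hvS]
      exact card_filter_le_lt_card_filter_le S hvS huv
    · have h1 := mt (hcS_iff v).1 hvS
      have h2 := (hcS_iff u).2 huS
      omega
  have hproper : properColoring G c := by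
    intro u v hadj
    rcases lt_or_gt_of_ne hadj.ne with h | h
    · exact (hinc u v h hadj).ne
    · exact (hinc v u h hadj.symm).ne'
  have hpal : usesPalette (List.replicate S.card 1 ++ [A.card, 1]) c := by
    refine ⟨by simpa using hc_le, ?_⟩
    rintro ⟨i, hi⟩
    have hi' : i < S.card + 2 := by simpa using hi
    rw [List.get_eq_getElem]
    dsimp only
    rcases lt_trichotomy i S.card with h | h | h
    · rw [List.getElem_append_left (by simpa using h), List.getElem_replicate,
        Nat.card_eq_one_iff_unique]
      obtain ⟨v, hvS, hv⟩ := exists_eq_card_filter_le S h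
      refine ⟨⟨?_⟩, ⟨⟨v, (hcS v hvS).trans hv⟩⟩⟩
      rintro ⟨p, hp⟩ ⟨q, hq⟩
      have hpS := (hcS_iff p).1 (by omega)
      have hqS := (hcS_iff q).1 (by omega)
      rw [hcS p hpS] at hp
      rw [hcS q hqS] at hq
      rw [Subtype.mk.injEq]
      rcases lt_trichotomy p q with h' | h' | h'
      · have : r p < r q := card_filter_le_lt_card_filter_le S hqS h'
        omega
      · exact h'
      · have : r q < r p := card_filter_le_lt_card_filter_le S hpS h'
        omega
    · subst h
      simp [hcA]
    · obtain rfl : i = S.card + 1 := by omega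
      simp [hcb]
  have hpos := NG_pos hproper hpal ((ascNum_eq_card_edges_iff G c).2 hinc)
  have hAsum : (List.replicate S.card 1 ++ [A.card, 1]).sum = n := by
    simpa using hcard
  have hperm : List.Perm (List.replicate S.card 1 ++ [A.card, 1])
      (List.replicate S.card 1 ++ [1, A.card]) := (List.Perm.swap _ _ _).append_left _
  have hmem : ∀ a ∈ List.replicate S.card 1 ++ [A.card, 1], 0 < a := by
    intro a ha
    simp only [List.mem_append, List.mem_replicate, List.mem_cons, List.not_mem_nil,
      or_false] at ha
    omega
  rw [hsymm _ _ ⟨hmem, hAsum⟩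
    ⟨fun a ha => hmem a (hperm.mem_iff.2 ha), hperm.sum_eq ▸ hAsum⟩ hperm] at hpos
  obtain ⟨⟨c', -, hpal', hasc'⟩⟩ := (Nat.card_pos_iff.1 hpos).1
  rw [ascNum_eq_card_edges_iff] at hasc'
  have hlast := hpal'.2 ⟨S.card + 1, by simp⟩
  have hle : Nat.card {v : Fin n // c' v = S.card + 1 + 1} ≤ T.card := by
    rw [Nat.card_eq_fintype_card, Fintype.card_subtype]
    refine Finset.card_le_card fun v hv => ?_
    simp only [Finset.mem_filter, Finset.mem_univ, true_and, hT] at hv ⊢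
    intro u hvu hadj
    have h1 := hasc' v u hvu hadj
    have h2 := (hpal'.1 u).2
    simp at h2
    omega
  have hget : (List.replicate S.card 1 ++ [1, A.card]).get ⟨S.card + 1, by simp⟩ = A.card := by
    simp
  rw [hget] at hlast
  dsimp only at hlast
  omega

theorem pathGraph_adj_iff {n : ℕ} (w : Equiv.Perm (Fin n)) (p q : Fin n) :
    (pathGraph w).Adj (w p) (w q) ↔ (p : ℕ) + 1 = q ∨ (q : ℕ) + 1 = p := by
  have key : ∀ p q : Fin n, (∃ i : ℕ, ∃ h : i + 1 < n,
      w p = w ⟨i, by omega⟩ ∧ w q = w ⟨i + 1, h⟩) ↔ (p : ℕ) + 1 = q := by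
    intro p q
    simp only [EmbeddingLike.apply_eq_iff_eq, Fin.ext_iff]
    constructor
    · rintro ⟨i, h, h1, h2⟩
      omega
    · intro h
      exact ⟨p, by omega, rfl, h.symm⟩
  rw [pathGraph, SimpleGraph.fromRel_adj, key, key, Ne, EmbeddingLike.apply_eq_iff_eq, Fin.ext_iff]
  omega

/-- A peak of `w` neither of whose neighbors in the path has a second larger neighbor prevents
symmetry. -/
theorem not_cqfSymmetric_pathGraph_of_peak {n : ℕ} (w : Equiv.Perm (Fin n)) (i : ℕ)
    (hi : i + 2 < n) (h1 : w ⟨i, by omega⟩ < w ⟨i + 1, by omega⟩)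
    (h2 : w ⟨i + 2, hi⟩ < w ⟨i + 1, by omega⟩)
    (hleft : ∀ p : Fin n, (p : ℕ) + 1 = i → w p < w ⟨i, by omega⟩)
    (hright : ∀ q : Fin n, (q : ℕ) = i + 3 → w q < w ⟨i + 2, hi⟩) :
    ¬ cqfSymmetric (pathGraph w) := by
  refine not_cqfSymmetric_of_unique_larger_neighbor (pathGraph w) (b := w ⟨i + 1, by omega⟩)
    (x := w ⟨i, by omega⟩) (y := w ⟨i + 2, hi⟩) ?_ (by simp) h1
    ((pathGraph_adj_iff w _ _).2 (by simp)) ?_ h2 ((pathGraph_adj_iff w _ _).2 (by simp)) ?_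
  all_goals
    intro v hv
    obtain ⟨q, rfl⟩ := w.surjective v
    rw [pathGraph_adj_iff]
    intro hq
    simp only at hq
  · rcases hq with hq | hq
    · obtain rfl : q = ⟨i + 2, hi⟩ := Fin.ext hq.symm
      exact absurd hv h2.asymm
    · have hqi : q = ⟨i, by omega⟩ := Fin.ext (by simpa using hq)
      rw [hqi] at hv
      exact absurd hv h1.asymm
  · rcases hq with hq | hq
    · exact congrArg w (Fin.ext hq.symm)
    · exact absurd hv (hleft q hq).asymm
  · rcases hq with hq | hq
    · exact absurd hv (hright q hq.symm).asymm
    · exact congrArg w (Fin.ext (by simpa using hq))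

theorem adPattern_getElem?_eq_some {n : ℕ} {w : Equiv.Perm (Fin n)} {j : ℕ} {t : Bool}
    (h : (adPattern w)[j]? = some t) :
    ∃ hj : j + 1 < n, if t then w ⟨j, by omega⟩ < w ⟨j + 1, hj⟩
      else w ⟨j + 1, hj⟩ < w ⟨j, by omega⟩ := by
  obtain ⟨hj, h⟩ := List.getElem?_eq_some_iff.1 h
  have hj' : j + 1 < n := by
    simp [adPattern] at hj
    omega
  refine ⟨hj', ?_⟩
  simp only [adPattern, List.getElem_ofFn] at h
  cases t
  · have hne : w ⟨j + 1, hj'⟩ ≠ w ⟨j, by omega⟩ := by simp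
    exact lt_of_le_of_ne (not_lt.1 (of_decide_eq_false h)) hne
  · exact of_decide_eq_true h

/-- If the ad-pattern of `w` contains `aadd` as a contiguous factor,
or begins with `add`, or ends with `aad`, then the CQF of `P_w` is not symmetric.
(Here `true` records `a` and `false` records `d`.) -/
theorem stmt9 (n : ℕ) (w : Equiv.Perm (Fin n))
    (h : [true, true, false, false] <:+: adPattern w ∨
         [true, false, false] <+: adPattern w ∨
         [true, true, false] <:+ adPattern w) :
    ¬ cqfSymmetric (pathGraph w) := by
  have letter : ∀ (s t l : List Bool), s ++ l ++ t = adPattern w → ∀ (j : ℕ) (a : Bool),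
      l[j]? = some a → (adPattern w)[s.length + j]? = some a := by
    intro s t l hl j a ha
    have hj := (List.getElem?_eq_some_iff.1 ha).1
    rw [← hl, List.append_assoc, List.getElem?_append_right (by omega), Nat.add_sub_cancel_left,
      List.getElem?_append_left hj, ha]
  rcases h with ⟨s, t, h⟩ | ⟨t, h⟩ | ⟨s, h⟩
  · obtain ⟨_, e0⟩ := adPattern_getElem?_eq_some (letter s t _ h 0 true rfl)
    obtain ⟨_, e1⟩ := adPattern_getElem?_eq_some (letter s t _ h 1 true rfl)
    obtain ⟨_, e2⟩ := adPattern_getElem?_eq_some (letter s t _ h 2 false rfl)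
    obtain ⟨_, e3⟩ := adPattern_getElem?_eq_some (letter s t _ h 3 false rfl)
    refine not_cqfSymmetric_pathGraph_of_peak w (s.length + 1) (by omega) e1 e2 ?_ ?_
    · intro p hp
      have hps : p = ⟨s.length, by omega⟩ := Fin.ext (by simpa using hp)
      rw [hps]
      exact e0
    · intro q hq
      obtain rfl : q = ⟨s.length + 4, by omega⟩ := Fin.ext hq
      exact e3
  · obtain ⟨_, e0⟩ := adPattern_getElem?_eq_some (letter [] t _ h 0 true rfl)
    obtain ⟨_, e1⟩ := adPattern_getElem?_eq_some (letter [] t _ h 1 false rfl)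
    obtain ⟨_, e2⟩ := adPattern_getElem?_eq_some (letter [] t _ h 2 false rfl)
    refine not_cqfSymmetric_pathGraph_of_peak w 0 (by assumption) e0 e1 ?_ ?_
    · intro p hp
      omega
    · intro q hq
      obtain rfl : q = ⟨3, by omega⟩ := Fin.ext hq
      exact e2
  · have hlen : s.length + 3 = n - 1 := by
      simpa [adPattern] using congrArg List.length h
    rw [← List.append_nil (s ++ _)] at h
    obtain ⟨_, e0⟩ := adPattern_getElem?_eq_some (letter s [] _ h 0 true rfl)
    obtain ⟨_, e1⟩ := adPattern_getElem?_eq_some (letter s [] _ h 1 true rfl)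
    obtain ⟨_, e2⟩ := adPattern_getElem?_eq_some (letter s [] _ h 2 false rfl)
    refine not_cqfSymmetric_pathGraph_of_peak w (s.length + 1) (by omega) e1 e2 ?_ ?_
    · intro p hp
      have hps : p = ⟨s.length, by omega⟩ := Fin.ext (by simpa using hp)
      rw [hps]
      exact e0
    · intro q hq
      omega
end

section
/- Let n ≥ 4 and let 1 ≤ j ≤ n. The chromatic quasisymmetric function of the labeled star K_{1,n−1} on {1,…,n} with central vertex j is not symmetric. -/
theorem starGraph_adj {n : ℕ} {j u v : Fin n} :
    (starGraph n j).Adj u v ↔ u ≠ v ∧ (u = j ∨ v = j) := by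
  simp only [starGraph, SimpleGraph.fromRel_adj]
  grind

theorem properColoring_starGraph {n : ℕ} {j : Fin n} {c : Fin n → ℕ} :
    properColoring (starGraph n j) c ↔ ∀ u, u ≠ j → c u ≠ c j := by
  simp only [properColoring, starGraph_adj]
  grind

/-- The ascents of a coloring of a star, indexed by the non-central endpoint. -/
theorem ascNum_starGraph {n : ℕ} (j : Fin n) (c : Fin n → ℕ) :
    ascNum (starGraph n j) c =
      (Finset.univ.filter fun u => (u < j ∧ c u < c j) ∨ (j < u ∧ c j < c u)).card := by
  rw [ascNum, ← Fintype.card_subtype, ← Nat.card_eq_fintype_card]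
  refine Nat.card_congr
    { toFun := fun p => ⟨if p.1.1 = j then p.1.2 else p.1.1, ?_⟩
      invFun := fun u => ⟨if u.1 < j then (u.1, j) else (j, u.1), ?_⟩
      left_inv := ?_
      right_inv := ?_ }
  · obtain ⟨⟨a, b⟩, h⟩ := p
    simp only [starGraph_adj] at h ⊢
    grind
  · obtain ⟨u, h⟩ := u
    simp only [starGraph_adj]
    grind
  · rintro ⟨⟨a, b⟩, h⟩
    simp only [starGraph_adj] at h
    simp only [Subtype.mk.injEq]
    grind
  · rintro ⟨u, h⟩
    simp only [Subtype.mk.injEq]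
    grind

/-- If the center gets the largest color, the ascents are the edges to smaller labels. -/
theorem ascNum_starGraph_of_forall_lt {n : ℕ} {j : Fin n} {c : Fin n → ℕ}
    (h : ∀ u, u ≠ j → c u < c j) : ascNum (starGraph n j) c = j := by
  rw [ascNum_starGraph, ← Fin.card_Iio j]
  congr 1
  ext u
  simp only [Finset.mem_filter, Finset.mem_univ, true_and, Finset.mem_Iio]
  have := h u
  grind

/-- If the center gets the smallest color, the ascents are the edges to larger labels. -/
theorem ascNum_starGraph_of_forall_gt {n : ℕ} {j : Fin n} {c : Fin n → ℕ}
    (h : ∀ u, u ≠ j → c j < c u) : ascNum (starGraph n j) c = n - 1 - j := by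
  rw [ascNum_starGraph, ← Fin.card_Ioi j]
  congr 1
  ext u
  simp only [Finset.mem_filter, Finset.mem_univ, true_and, Finset.mem_Ioi]
  have := h u
  grind

/-- The color of the center of a star is used only once. -/
theorem card_center_color {n : ℕ} {j : Fin n} {c : Fin n → ℕ}
    (h : properColoring (starGraph n j) c) : Nat.card {v : Fin n // c v = c j} = 1 := by
  rw [properColoring_starGraph] at h
  rw [Nat.card_eq_one_iff_unique]
  refine ⟨⟨fun a b => Subtype.ext ?_⟩, ⟨⟨j, rfl⟩⟩⟩
  have ha := h a
  have hb := h b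
  grind

theorem NG_ne_zero {n : ℕ} {G : SimpleGraph (Fin n)} {L : List ℕ} {k : ℕ} {c : Fin n → ℕ}
    (hc : properColoring G c) (hL : usesPalette L c) (hk : ascNum G c = k) : NG G L k ≠ 0 := by
  have hfin : Finite {c : Fin n → ℕ // properColoring G c ∧ usesPalette L c ∧ ascNum G c = k} := by
    refine Finite.of_injective
      (fun d (v : Fin n) => (⟨d.1 v, Nat.lt_succ_of_le (d.2.2.1.1 v).2⟩ : Fin (L.length + 1))) ?_
    intro d e hde
    ext v
    simpa using congrFun hde v
  have : Nonempty {c : Fin n → ℕ // properColoring G c ∧ usesPalette L c ∧ ascNum G c = k} :=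
    ⟨⟨c, hc, hL, hk⟩⟩
  exact Nat.pos_iff_ne_zero.mp Nat.card_pos

theorem NG_eq_zero {n : ℕ} {G : SimpleGraph (Fin n)} {L : List ℕ} {k : ℕ}
    (h : ∀ c, properColoring G c → usesPalette L c → ascNum G c ≠ k) : NG G L k = 0 := by
  have : IsEmpty {c : Fin n → ℕ // properColoring G c ∧ usesPalette L c ∧ ascNum G c = k} :=
    ⟨fun c => h c.1 c.2.1 c.2.2.1 c.2.2.2⟩
  exact Nat.card_of_isEmpty

/-- If the two sides of the center differ in size, the compositions `(1, n-1)` and `(n-1, 1)`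
witness that the CQF is not symmetric. -/
theorem not_cqfSymmetric_starGraph_of_ne {n : ℕ} (hn : 4 ≤ n) {j : Fin n}
    (hj : (j : ℕ) ≠ n - 1 - j) : ¬ cqfSymmetric (starGraph n j) := by
  intro h
  have key := h [1, n - 1] [n - 1, 1] (by constructor <;> simp <;> omega)
    (by constructor <;> simp <;> omega) (List.Perm.swap _ _ _) (n - 1 - j)
  refine NG_ne_zero (c := fun v => if v = j then 1 else 2) ?_ ?_ ?_ (key.trans (NG_eq_zero ?_))
  · rw [properColoring_starGraph]
    intro u hu
    simp [hu]
  · refine ⟨fun v => by dsimp only; split <;> simp, fun i => ?_⟩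
    rw [Nat.card_eq_fintype_card, Fintype.card_subtype]
    fin_cases i
    · trans ({j} : Finset (Fin n)).card
      · congr 1; ext v; simp
      · simp
    · trans (Finset.univ.erase j).card
      · congr 1; ext v; simp
      · simp
  · exact ascNum_starGraph_of_forall_gt fun u hu => by simp [hu]
  · intro c hc hp hk
    have h1 := card_center_color hc
    have hp0 := hp.2 ⟨0, by simp⟩
    have hb := hp.1
    simp only [List.length_cons, List.length_nil, zero_add, List.get_eq_getElem,
      List.getElem_cons_zero] at hp0 hb
    have hne : c j ≠ 1 := fun h => by rw [h] at h1; omega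
    rw [properColoring_starGraph] at hc
    refine hj (.trans (ascNum_starGraph_of_forall_lt fun u hu => ?_).symm hk)
    have := hc u hu
    have := hb u
    have := hb j
    omega

/-- If the center is the middle label, the compositions `(1, 1, n-2)` and `(1, n-2, 1)`
witness that the CQF is not symmetric. -/
theorem not_cqfSymmetric_starGraph_of_eq {n : ℕ} (hn : 4 ≤ n) {j : Fin n}
    (hj : (j : ℕ) = n - 1 - j) : ¬ cqfSymmetric (starGraph n j) := by
  intro h
  have key := h [1, 1, n - 2] [1, n - 2, 1] (by constructor <;> simp <;> omega)
    (by constructor <;> simp <;> omega) ((List.Perm.swap _ _ _).cons _) (n - 1 - j + 1)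
  obtain ⟨w, hw⟩ : ∃ w : Fin n, w < j := ⟨⟨0, by omega⟩, by rw [Fin.lt_def]; dsimp only; omega⟩
  refine NG_ne_zero (c := fun v => if v = j then 2 else if v = w then 1 else 3) ?_ ?_ ?_
    (key.trans (NG_eq_zero ?_))
  · rw [properColoring_starGraph]
    intro u hu
    by_cases u = w <;> simp [*, hw.ne]
  · refine ⟨fun v => by dsimp only; split_ifs <;> simp, fun i => ?_⟩
    rw [Nat.card_eq_fintype_card, Fintype.card_subtype]
    fin_cases i
    · trans ({w} : Finset (Fin n)).card
      · congr 1; ext v; simp; grind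
      · simp
    · trans ({j} : Finset (Fin n)).card
      · congr 1; ext v; simp; grind
      · simp
    · trans ((Finset.univ.erase j).erase w).card
      · congr 1; ext v; simp; grind
      · rw [Finset.card_erase_of_mem (by simp [hw.ne]), Finset.card_erase_of_mem (by simp)]
        simp
        omega
  · rw [ascNum_starGraph, ← Fin.card_Ioi j,
      ← Finset.card_insert_of_notMem (s := Finset.Ioi j) (a := w) (by simp [hw.le])]
    congr 1
    ext u
    simp only [Finset.mem_filter, Finset.mem_univ, true_and, Finset.mem_insert, Finset.mem_Ioi]
    grind
  · intro c hc hp hk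
    have h1 := card_center_color hc
    have hp1 := hp.2 ⟨1, by simp⟩
    have hb := hp.1
    simp only [List.length_cons, List.length_nil, zero_add, List.get_eq_getElem,
      List.getElem_cons_zero, List.getElem_cons_succ, Nat.reduceAdd] at hp1 hb
    have hne : c j ≠ 2 := fun h => by rw [h] at h1; omega
    rw [properColoring_starGraph] at hc
    have hbj := hb j
    obtain h | h : c j = 1 ∨ c j = 3 := by omega
    · have := ascNum_starGraph_of_forall_gt (j := j) (c := c) fun u hu => by
        have := hc u hu
        have := hb u
        omega
      omega
    · have := ascNum_starGraph_of_forall_lt (j := j) (c := c) fun u hu => by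
        have := hc u hu
        have := hb u
        omega
      omega

/-- For `n ≥ 4`, the CQF of a labeled star `K_{1,n-1}` is never
symmetric. -/
theorem stmt12 (n : ℕ) (hn : 4 ≤ n) (j : Fin n) :
    ¬ cqfSymmetric (starGraph n j) := by
  by_cases hj : (j : ℕ) = n - 1 - j
  · exact not_cqfSymmetric_starGraph_of_eq hn hj
  · exact not_cqfSymmetric_starGraph_of_ne hn hj
end

section
/- Let T be a labeled tree on n vertices (a connected acyclic simple graph with vertex set {1,…,n}) with n even, and suppose that the two classes A and B of the bipartition of T satisfy |A| ≠ |B|. Then the chromatic quasisymmetric function of T is not palindromic, and in particular not symmetric. -/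
/-- Two proper colorings of a preconnected graph with values in `{1, 2}` agree everywhere
or nowhere. -/
theorem eq_iff_eq_of_preconnected {n : ℕ} {G : SimpleGraph (Fin n)} (hG : G.Preconnected)
    {c d : Fin n → ℕ} (hc : properColoring G c) (hd : properColoring G d)
    (hc2 : ∀ v, 1 ≤ c v ∧ c v ≤ 2) (hd2 : ∀ v, 1 ≤ d v ∧ d v ≤ 2) (u v : Fin n) :
    c u = d u ↔ c v = d v := by
  obtain ⟨w⟩ := hG u v
  induction w with
  | nil => rfl
  | cons h _ ih =>
    rw [← ih]
    have h1 := hc _ _ h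
    have h2 := hd _ _ h
    rename_i x y z _
    have := hc2 x
    have := hc2 y
    have := hd2 x
    have := hd2 y
    omega

theorem edgeCount_eq_card_pairs {n : ℕ} (G : SimpleGraph (Fin n)) :
    edgeCount G = Nat.card {p : Fin n × Fin n // p.1 < p.2 ∧ G.Adj p.1 p.2} := by
  symm
  refine Nat.card_congr (Equiv.ofBijective
    (fun p => ⟨s(p.1.1, p.1.2), (SimpleGraph.mem_edgeSet G).2 p.2.2⟩) ⟨?_, ?_⟩)
  · rintro ⟨⟨a, b⟩, h, _⟩ ⟨⟨a', b'⟩, h', _⟩ heq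
    simp only [Subtype.mk.injEq, Sym2.eq_iff] at heq
    dsimp only at h h'
    rcases heq with ⟨rfl, rfl⟩ | ⟨rfl, rfl⟩
    · rfl
    · exact absurd h (lt_asymm h')
  · rintro ⟨e, he⟩
    induction e using Sym2.ind with
    | _ a b =>
      have hab : G.Adj a b := he
      rcases lt_or_gt_of_ne hab.ne with h | h
      · exact ⟨⟨(a, b), h, hab⟩, rfl⟩
      · exact ⟨⟨(b, a), h, hab.symm⟩, Subtype.ext Sym2.eq_swap⟩

theorem ascNum_add_desNum {n : ℕ} {G : SimpleGraph (Fin n)} {c : Fin n → ℕ}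
    (hc : properColoring G c) : ascNum G c + desNum G c = edgeCount G := by
  classical
  rw [edgeCount_eq_card_pairs, ascNum, desNum]
  simp only [Nat.card_eq_fintype_card, Fintype.card_subtype]
  rw [← Finset.card_union_of_disjoint]
  · congr 1
    ext p
    simp only [Finset.mem_union, Finset.mem_filter, Finset.mem_univ, true_and]
    have := hc p.1 p.2
    grind
  · rw [Finset.disjoint_left]
    intro p hp hq
    simp only [Finset.mem_filter, Finset.mem_univ, true_and] at hp hq
    omega

/-- The coloring with color `1` on `A` and color `2` off `A`. -/
def twoColoring {n : ℕ} (A : Finset (Fin n)) (v : Fin n) : ℕ := if v ∈ A then 1 else 2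

theorem one_le_twoColoring_le_two {n : ℕ} (A : Finset (Fin n)) (v : Fin n) :
    1 ≤ twoColoring A v ∧ twoColoring A v ≤ 2 := by
  unfold twoColoring
  split_ifs <;> simp

theorem desNum_twoColoring {n : ℕ} (G : SimpleGraph (Fin n)) {A B : Finset (Fin n)}
    (h : ∀ v, v ∈ B ↔ v ∉ A) : desNum G (twoColoring A) = ascNum G (twoColoring B) := by
  unfold desNum ascNum
  refine Nat.card_congr (Equiv.subtypeEquivRight fun p => ?_)
  have h1 := h p.1
  have h2 := h p.2
  unfold twoColoring
  grind

theorem properColoring_twoColoring {n : ℕ} {G : SimpleGraph (Fin n)} {A B : Finset (Fin n)}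
    (h : ∀ v, v ∈ B ↔ v ∉ A) (hA : ∀ u ∈ A, ∀ v ∈ A, ¬ G.Adj u v)
    (hB : ∀ u ∈ B, ∀ v ∈ B, ¬ G.Adj u v) : properColoring G (twoColoring A) := by
  intro u v huv
  have := hA u
  have := hB u
  unfold twoColoring
  grind

theorem usesPalette_twoColoring {n : ℕ} {A B : Finset (Fin n)} (h : ∀ v, v ∈ B ↔ v ∉ A) :
    usesPalette [A.card, B.card] (twoColoring A) := by
  refine ⟨one_le_twoColoring_le_two A, fun i => ?_⟩
  rw [Nat.card_eq_fintype_card, Fintype.card_subtype]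
  fin_cases i
  · change _ = A.card
    congr 1
    ext v
    simp [twoColoring]
  · change _ = B.card
    congr 1
    ext v
    simp [twoColoring, h]

/-- In a connected bipartite graph with classes of different sizes, the only proper coloring
with palette given by the sizes of the two classes colors the first class `1`. -/
theorem eq_twoColoring {n : ℕ} {G : SimpleGraph (Fin n)} (hG : G.Preconnected)
    {A B : Finset (Fin n)} (h : ∀ v, v ∈ B ↔ v ∉ A) (hA : ∀ u ∈ A, ∀ v ∈ A, ¬ G.Adj u v)
    (hB : ∀ u ∈ B, ∀ v ∈ B, ¬ G.Adj u v) (hcard : A.card ≠ B.card) {c : Fin n → ℕ}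
    (hc : properColoring G c) (hp : usesPalette [A.card, B.card] c) : c = twoColoring A := by
  by_contra hne
  obtain ⟨u, hu⟩ := Function.ne_iff.1 hne
  have hdiff : ∀ v, c v ≠ twoColoring A v := fun v hv =>
    hu ((eq_iff_eq_of_preconnected hG hc (properColoring_twoColoring h hA hB) hp.1
      (one_le_twoColoring_le_two A) u v).2 hv)
  have hcount : Nat.card {v : Fin n // c v = 0 + 1} = A.card := hp.2 ⟨0, by simp⟩
  apply hcard
  rw [← hcount, Nat.card_eq_fintype_card, Fintype.card_subtype]
  congr 1
  ext v
  have h1 : 1 ≤ c v ∧ c v ≤ 2 := hp.1 v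
  have h2 := hdiff v
  have h3 := h v
  unfold twoColoring at h2
  simp only [Finset.mem_filter, Finset.mem_univ, true_and, zero_add]
  grind

theorem NG_pair {n : ℕ} {G : SimpleGraph (Fin n)} (hG : G.Preconnected)
    {A B : Finset (Fin n)} (h : ∀ v, v ∈ B ↔ v ∉ A) (hA : ∀ u ∈ A, ∀ v ∈ A, ¬ G.Adj u v)
    (hB : ∀ u ∈ B, ∀ v ∈ B, ¬ G.Adj u v) (hcard : A.card ≠ B.card) (k : ℕ) :
    NG G [A.card, B.card] k = if ascNum G (twoColoring A) = k then 1 else 0 := by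
  unfold NG
  split_ifs with hk
  · rw [Nat.card_eq_one_iff_unique]
    refine ⟨⟨fun c d => Subtype.ext ?_⟩, ⟨⟨twoColoring A, properColoring_twoColoring h hA hB,
      usesPalette_twoColoring h, hk⟩⟩⟩
    rw [eq_twoColoring hG h hA hB hcard c.2.1 c.2.2.1,
      eq_twoColoring hG h hA hB hcard d.2.1 d.2.2.1]
  · have : IsEmpty {c : Fin n → ℕ // properColoring G c ∧ usesPalette [A.card, B.card] c ∧
        ascNum G c = k} :=
      ⟨fun c => hk (eq_twoColoring hG h hA hB hcard c.2.1 c.2.2.1 ▸ c.2.2.2)⟩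
    exact Nat.card_of_isEmpty

theorem edgeCount_add_one {n : ℕ} {G : SimpleGraph (Fin n)} (hG : G.IsTree) :
    edgeCount G + 1 = n := by
  classical
  have := hG.card_edgeFinset
  rwa [Fintype.card_fin, SimpleGraph.edgeFinset_card, ← Nat.card_eq_fintype_card] at this

/-- In a connected graph with at least two vertices, the complement of an independent set is
nonempty. -/
theorem card_pos_of_compl_independent {n : ℕ} {G : SimpleGraph (Fin n)} (hG : G.Preconnected)
    (hn : 2 ≤ n) {A B : Finset (Fin n)} (h : ∀ v, v ∈ B ↔ v ∉ A)
    (hA : ∀ u ∈ A, ∀ v ∈ A, ¬ G.Adj u v) : 0 < B.card := by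
  have : Nontrivial (Fin n) := Fin.nontrivial_iff_two_le.2 hn
  obtain ⟨v, hv⟩ := hG.exists_adj_of_nontrivial (⟨0, by omega⟩ : Fin n)
  rw [Finset.card_pos]
  by_contra hB
  rw [Finset.not_nonempty_iff_eq_empty] at hB
  have hmem : ∀ x, x ∈ A := fun x => by
    have := h x
    simp_all
  exact hA _ (hmem _) _ (hmem _) hv

/-- A labeled tree on an even number of vertices whose bipartition
classes have unequal sizes has a non-palindromic (hence nonsymmetric) CQF. -/
theorem stmt14 (n : ℕ) (hn : Even n) (G : SimpleGraph (Fin n))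
    (hconn : G.Connected) (hacyc : G.IsAcyclic)
    (A B : Finset (Fin n))
    (hdisj : Disjoint A B) (hunion : A ∪ B = Finset.univ)
    (hAind : ∀ u ∈ A, ∀ v ∈ A, ¬ G.Adj u v)
    (hBind : ∀ u ∈ B, ∀ v ∈ B, ¬ G.Adj u v)
    (hcard : A.card ≠ B.card) :
    ¬ cqfPalindromic G ∧ ¬ cqfSymmetric G := by
  
  have hBA : ∀ v, v ∈ B ↔ v ∉ A := fun v => by
    have h1 : v ∈ A ∪ B := hunion ▸ Finset.mem_univ v
    rw [Finset.mem_union] at h1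
    have h2 : v ∈ A → v ∉ B := fun ha => Finset.disjoint_left.1 hdisj ha
    tauto
  have hAB : ∀ v, v ∈ A ↔ v ∉ B := fun v => by
    have := hBA v
    tauto
  have hm := edgeCount_add_one (G := G) ⟨hconn, hacyc⟩
  have hn2 : 2 ≤ n := by
    obtain ⟨v⟩ := hconn.nonempty
    have := v.isLt
    obtain ⟨r, hr⟩ := hn
    omega
  have hApos := card_pos_of_compl_independent hconn.preconnected hn2 hAB hBind
  have hBpos := card_pos_of_compl_independent hconn.preconnected hn2 hBA hAind
  have hsum : A.card + B.card = n := by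
    rw [← Finset.card_union_of_disjoint hdisj, hunion, Finset.card_univ, Fintype.card_fin]
  have hcompA : IsComposition n [A.card, B.card] := by
    refine ⟨?_, by simpa using hsum⟩
    simp [hApos, hBpos]
  have hcompB : IsComposition n [B.card, A.card] := by
    refine ⟨?_, by simpa [add_comm] using hsum⟩
    simp [hApos, hBpos]
  have hadd := ascNum_add_desNum (properColoring_twoColoring hBA hAind hBind)
  rw [desNum_twoColoring G hBA] at hadd
  obtain ⟨r, hr⟩ := hn
  have hNG := NG_pair hconn.preconnected hBA hAind hBind hcard
  constructor
  · intro hpal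
    have h := hpal _ hcompA (ascNum G (twoColoring A)) (by omega)
    rw [hNG, hNG, if_pos rfl, if_neg (by omega)] at h
    exact one_ne_zero h
  · intro hsym
    have h := hsym _ _ hcompA hcompB (List.Perm.swap _ _ _) (ascNum G (twoColoring A))
    rw [hNG, NG_pair hconn.preconnected hAB hBind hAind hcard.symm, if_pos rfl,
      if_neg (by omega)] at h
    exact one_ne_zero h
end
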